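/- Let d ≥ 1, k ≥ 1 be fixed integers, s ∈ (0,2] and L > 0. There exists a constant C depending only on s, L, d and k such that for every n ≥ k and every probability density f in the Hölder ball H^s_d(L;[0,1]^d), if X, X_1,…,X_n are i.i.d. samples from f and R_k(X) denotes the k-th smallest torus distance from X to X_1,…,X_n, then E[ ln( f(X) / f_{R_k(X)}(X) ) ] ≤ C n^{−s/(s+d)} ln(n+1) (the expectation being over both X and the sample, and well-defined since f(X) > 0 almost surely). -/

import Mathlib

open MeasureTheory Real

noncomputable section

abbrev Euc (d : ℕ) : Type := EuclideanSpace ℝ (Fin d)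

/-- The unit cube `[0,1]^d`. -/
def unitCube (d : ℕ) : Set (Euc d) := {x | ∀ i, x i ∈ Set.Icc (0:ℝ) 1}

/-- Volume of the unit Euclidean ball in `ℝ^d`. -/
def unitBallVol (d : ℕ) : ℝ := Real.pi ^ ((d : ℝ) / 2) / Real.Gamma (1 + (d : ℝ) / 2)

/-- The point of `ℝ^d` with integer coordinates `m`. -/
def intVec (d : ℕ) (m : Fin d → ℤ) : Euc d :=
  (WithLp.equiv 2 (Fin d → ℝ)).symm fun i => (m i : ℝ)

/-- Torus distance: `d(x,y) = min_{m ∈ ℤ^d} ‖x + m - y‖`. -/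
def torusDist (d : ℕ) (x y : Euc d) : ℝ :=
  ⨅ m : Fin d → ℤ, ‖x + intVec d m - y‖

/-- `(s,L)`-Hölder condition for `s ∈ (0,2]`. -/
def IsHolderOrder (d : ℕ) (s L : ℝ) (f : Euc d → ℝ) : Prop :=
  if s ≤ 1 then
    ∀ x y : Euc d, |f x - f y| ≤ L * ‖x - y‖ ^ s
  else
    ContDiff ℝ 1 f ∧ ∀ x y : Euc d, ‖gradient f x - gradient f y‖ ≤ L * ‖x - y‖ ^ (s - 1)

/-- `f` is 1-periodic in each coordinate. -/
def IsPeriodic (d : ℕ) (f : Euc d → ℝ) : Prop :=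
  ∀ (x : Euc d) (i : Fin d), f (x + EuclideanSpace.single i 1) = f x

/-- Probability density in the Hölder ball `H^s_d(L;[0,1]^d)`, represented by its
1-periodic extension to `ℝ^d`. -/
def HolderDensity (d : ℕ) (s L : ℝ) (f : Euc d → ℝ) : Prop :=
  IsHolderOrder d s L f ∧ IsPeriodic d f ∧ (∀ x, 0 ≤ f x) ∧
    (∫ x in unitCube d, f x) = 1

/-- The probability measure on `[0,1]^d` with density `f`. -/
def densityMeasure (d : ℕ) (f : Euc d → ℝ) : Measure (Euc d) :=
  (volume.restrict (unitCube d)).withDensity fun x => ENNReal.ofReal (f x)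

/-- Law of `n` i.i.d. samples from density `f`. -/
def sampleMeasure (d n : ℕ) (f : Euc d → ℝ) : Measure (Fin n → Euc d) :=
  Measure.pi fun _ => densityMeasure d f

/-- The `k`-th smallest element (1-indexed) of a multiset of reals. -/
def kthSmallest (s : Multiset ℝ) (k : ℕ) : ℝ :=
  (s.sort (· ≤ ·)).getD (k - 1) 0

/-- `R_{i,k}`: the `k`-nearest neighbor torus distance from `X i` to the other points. -/
def nnDist (d n : ℕ) (X : Fin n → Euc d) (i : Fin n) (k : ℕ) : ℝ :=
  kthSmallest ((Finset.univ.erase i).val.map fun j => torusDist d (X i) (X j)) k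

/-- The digamma function: derivative of `ln Γ`. -/
def digamma (x : ℝ) : ℝ := deriv (fun y => Real.log (Real.Gamma y)) x

/-- The Kozachenko–Leonenko `k`-nearest neighbor differential entropy estimator. -/
def klEstimator (d k n : ℕ) (X : Fin n → Euc d) : ℝ :=
  Real.log k - digamma k +
    (1 / n : ℝ) * ∑ i : Fin n, Real.log ((n / k : ℝ) * (unitBallVol d * nnDist d n X i k ^ d))

/-- Differential entropy `h(f) = -∫_{[0,1]^d} f ln f`. -/
def diffEntropy (d : ℕ) (f : Euc d → ℝ) : ℝ :=
  -∫ x in unitCube d, f x * Real.log (f x)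

end

noncomputable section

/-- `f_t(x)`: the average of `f` over the closed Euclidean ball `B(x,t)`,
`f_t(x) = (1/(V_d t^d)) ∫_{‖u-x‖ ≤ t} f(u) du`. -/
def ballAvg (d : ℕ) (f : Euc d → ℝ) (t : ℝ) (x : Euc d) : ℝ :=
  (1 / (unitBallVol d * t ^ d)) * ∫ u in Metric.closedBall x t, f u

/-- `R_k(x)`: the `k`-th smallest torus distance from the point `x` to the sample points. -/
def RkOfPoint (d n k : ℕ) (x : Euc d) (X : Fin n → Euc d) : ℝ :=
  kthSmallest (Finset.univ.val.map fun j : Fin n => torusDist d x (X j)) k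

end

noncomputable section

theorem abs_sub_sub_fderiv_le {d : ℕ} {s L : ℝ} (hs1 : 1 < s) (hL : 0 < L) {f : Euc d → ℝ}
    (hf : IsHolderOrder d s L f) (x y : Euc d) :
    |f y - f x - fderiv ℝ f x (y - x)| ≤ L * ‖y - x‖ ^ s := by
  rw [IsHolderOrder, if_neg (not_le.2 hs1)] at hf
  obtain ⟨hc, hg⟩ := hf
  have hd : Differentiable ℝ f := hc.differentiable one_ne_zero
  have key := (convex_closedBall x ‖y - x‖).norm_image_sub_le_of_norm_fderiv_le' (𝕜 := ℝ)
    (f := f) (φ := fderiv ℝ f x) (C := L * ‖y - x‖ ^ (s - 1)) (x := x) (y := y)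
    (fun z _ => hd z) (fun z hz => by
      have h1 := hg z x
      rw [gradient, gradient, ← map_sub, LinearIsometryEquiv.norm_map] at h1
      refine h1.trans ?_
      have : ‖z - x‖ ≤ ‖y - x‖ := by simpa [dist_eq_norm] using hz
      have hs' : 0 ≤ s - 1 := by linarith
      gcongr) (by simp) (by simp [dist_eq_norm])
  rw [Real.norm_eq_abs] at key
  refine key.trans (le_of_eq ?_)
  rcases (norm_nonneg (y - x)).eq_or_lt with h0 | h0
  · rw [← h0, mul_zero, Real.zero_rpow (by linarith), mul_zero]
  · rw [Real.rpow_sub_one h0.ne']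
    field_simp

theorem IsHolderOrder.continuous {d : ℕ} {s L : ℝ} (hs : 0 < s) {f : Euc d → ℝ}
    (hf : IsHolderOrder d s L f) : Continuous f := by
  rw [IsHolderOrder] at hf
  split_ifs at hf with h
  · rw [continuous_iff_continuousAt]
    intro x
    rw [ContinuousAt, tendsto_iff_dist_tendsto_zero]
    have h1 : Filter.Tendsto (fun y => L * ‖y - x‖ ^ s) (nhds x) (nhds 0) := by
      have : Continuous fun y : Euc d => L * ‖y - x‖ ^ s :=
        continuous_const.mul ((continuous_id.sub continuous_const).norm.rpow_const
          fun _ => Or.inr hs.le)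
      simpa [Real.zero_rpow hs.ne'] using this.tendsto x
    exact squeeze_zero (fun _ => dist_nonneg) (fun y => by simpa [Real.dist_eq] using hf y x) h1
  · exact hf.1.continuous

theorem two_mul_sub_le_add_of_isHolderOrder {d : ℕ} {s L : ℝ} (hL : 0 < L) {f : Euc d → ℝ}
    (hf : IsHolderOrder d s L f) (x v : Euc d) :
    2 * f x - 2 * (L * ‖v‖ ^ s) ≤ f (x + v) + f (x - v) := by
  rcases le_or_gt s 1 with h | h
  · rw [IsHolderOrder, if_pos h] at hf
    have h1 := abs_le.1 (hf (x + v) x)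
    have h2 := abs_le.1 (hf (x - v) x)
    simp only [add_sub_cancel_left, sub_sub_cancel_left, norm_neg] at h1 h2
    linarith [h1.1, h2.1]
  · have h1 := abs_le.1 (abs_sub_sub_fderiv_le h hL hf x (x + v))
    have h2 := abs_le.1 (abs_sub_sub_fderiv_le h hL hf x (x - v))
    simp only [add_sub_cancel_left, sub_sub_cancel_left, norm_neg, map_neg] at h1 h2
    linarith [h1.1, h2.1]

theorem norm_gradient_le_of_nonneg {d : ℕ} {s L : ℝ} (hs1 : 1 < s) (hL : 0 < L) {f : Euc d → ℝ}
    (hf : IsHolderOrder d s L f) (h0 : ∀ x, 0 ≤ f x) {x : Euc d} {τ : ℝ} (hτ : 0 < τ) :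
    ‖gradient f x‖ * τ ≤ f x + L * τ ^ s := by
  set g := gradient f x with hg
  rcases eq_or_ne g 0 with h | h
  · rw [h, norm_zero, zero_mul]
    have := h0 x
    positivity
  · have hn : 0 < ‖g‖ := norm_pos_iff.2 h
    have h1 := abs_le.1 (abs_sub_sub_fderiv_le hs1 hL hf x (x - (τ / ‖g‖) • g))
    have h2 : fderiv ℝ f x g = ‖g‖ ^ 2 := by
      rw [← real_inner_self_eq_norm_sq, hg, gradient, InnerProductSpace.toDual_symm_apply]
    have h3 : ‖(τ / ‖g‖) • g‖ = τ := by
      rw [norm_smul, Real.norm_of_nonneg (by positivity)]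
      field_simp
    simp only [sub_sub_cancel_left, norm_neg, map_neg, map_smul, h2, h3, smul_eq_mul] at h1
    have h4 : τ / ‖g‖ * ‖g‖ ^ 2 = ‖g‖ * τ := by field_simp
    have := h0 (x - (τ / ‖g‖) • g)
    linarith [h1.2]

/-- A nonnegative Hölder function stays above half its value at `x` on a ball around `x` whose
radius is proportional to `f x ^ (1 / s)`. -/
theorem exists_half_le_of_nonneg {s L : ℝ} (hs : 0 < s) (hL : 0 < L) :
    ∃ c : ℝ, 0 < c ∧ c ≤ 1 ∧ ∀ (d : ℕ) (f : Euc d → ℝ), IsHolderOrder d s L f → (∀ x, 0 ≤ f x) →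
      ∀ x y : Euc d, ‖y - x‖ ≤ c * f x ^ (1 / s) → f x / 2 ≤ f y := by
  set a : ℝ := 1 / (4 * (1 + L)) with ha
  have ha0 : 0 < a := by positivity
  have ha1 : a ≤ 1 := by
    rw [ha, div_le_one (by positivity)]
    linarith
  have hmul : a * (1 + L) = 1 / 4 := by
    rw [ha]
    field_simp
  set c : ℝ := min a (a ^ (1 / s)) with hc
  have hc0 : 0 < c := lt_min ha0 (by positivity)
  have hca : c ≤ a := min_le_left _ _
  have hcs : c ^ s ≤ a := by
    calc c ^ s ≤ (a ^ (1 / s)) ^ s := Real.rpow_le_rpow hc0.le (min_le_right _ _) hs.le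
      _ = a := by rw [← Real.rpow_mul ha0.le, one_div_mul_cancel hs.ne', Real.rpow_one]
  refine ⟨c, hc0, hca.trans ha1, fun d f hf h0 x y hy => ?_⟩
  rcases (h0 x).eq_or_lt with hx | hx
  · rw [← hx, zero_div]
    exact h0 y
  set τ : ℝ := f x ^ (1 / s) with hτ
  have hτ0 : 0 < τ := by positivity
  have hτs : τ ^ s = f x := by
    rw [hτ, ← Real.rpow_mul hx.le, one_div_mul_cancel hs.ne', Real.rpow_one]
  have hyn : L * ‖y - x‖ ^ s ≤ f x / 4 := by
    calc L * ‖y - x‖ ^ s ≤ L * (c * τ) ^ s := by gcongr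
      _ = L * c ^ s * f x := by rw [Real.mul_rpow hc0.le hτ0.le, hτs, mul_assoc]
      _ ≤ L * a * f x := by gcongr
      _ ≤ f x / 4 := by nlinarith
  rcases le_or_gt s 1 with h | h
  · rw [IsHolderOrder, if_pos h] at hf
    have := abs_le.1 (hf y x)
    linarith [this.1]
  · have h1 := norm_gradient_le_of_nonneg h hL hf h0 (x := x) hτ0
    rw [hτs] at h1
    have h2 := (abs_le.1 (abs_sub_sub_fderiv_le h hL hf x y)).1
    have h3 : |fderiv ℝ f x (y - x)| ≤ f x / 4 := by
      have e : fderiv ℝ f x (y - x) = inner ℝ (gradient f x) (y - x) := by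
        rw [gradient, InnerProductSpace.toDual_symm_apply]
      rw [e]
      calc |inner ℝ (gradient f x) (y - x)| ≤ ‖gradient f x‖ * ‖y - x‖ := abs_real_inner_le_norm _ _
        _ ≤ ‖gradient f x‖ * (a * τ) := by
          gcongr
          exact hy.trans (by gcongr)
        _ = a * (‖gradient f x‖ * τ) := by ring
        _ ≤ a * (f x + L * f x) := by gcongr
        _ = a * (1 + L) * f x := by ring
        _ = f x / 4 := by rw [hmul]; ring
    linarith [(abs_le.1 h3).1]

theorem unitBallVol_pos (d : ℕ) : 0 < unitBallVol d := by
  have : 0 < Real.Gamma (1 + (d : ℝ) / 2) := Real.Gamma_pos_of_pos (by positivity)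
  unfold unitBallVol
  positivity

theorem volume_real_closedBall_eq {d : ℕ} (hd : 1 ≤ d) (x : Euc d) {t : ℝ} (ht : 0 ≤ t) :
    volume.real (Metric.closedBall x t) = unitBallVol d * t ^ d := by
  have : Nonempty (Fin d) := ⟨⟨0, hd⟩⟩
  have h : √π ^ d / Real.Gamma ((d : ℝ) / 2 + 1) = unitBallVol d := by
    rw [unitBallVol, add_comm, Real.sqrt_eq_rpow, ← Real.rpow_natCast, ← Real.rpow_mul pi_pos.le]
    congr 2
    ring
  rw [measureReal_def, EuclideanSpace.volume_closedBall, Fintype.card_fin, h, ENNReal.toReal_mul,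
    ENNReal.toReal_pow, ENNReal.toReal_ofReal ht, ENNReal.toReal_ofReal (unitBallVol_pos d).le,
    mul_comm]

theorem integrableOn_closedBall_of_continuous {d : ℕ} {f : Euc d → ℝ} (hf : Continuous f)
    (x : Euc d) (t : ℝ) : IntegrableOn f (Metric.closedBall x t) :=
  hf.continuousOn.integrableOn_compact (isCompact_closedBall x t)

theorem le_ballAvg_of_le {d : ℕ} (hd : 1 ≤ d) {f : Euc d → ℝ} (hf : Continuous f) {x : Euc d}
    {a t : ℝ} (ht : 0 < t) (h : ∀ y, ‖y - x‖ ≤ t → a ≤ f y) : a ≤ ballAvg d f t x := by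
  have hV := unitBallVol_pos d
  have h1 : (∫ _ in Metric.closedBall x t, a) ≤ ∫ u in Metric.closedBall x t, f u := by
    refine setIntegral_mono_on (integrableOn_closedBall_of_continuous continuous_const x t)
      (integrableOn_closedBall_of_continuous hf x t) measurableSet_closedBall fun y hy => h y ?_
    simpa [dist_eq_norm] using hy
  rw [setIntegral_const, volume_real_closedBall_eq hd x ht.le, smul_eq_mul] at h1
  rw [ballAvg, one_div_mul_eq_div, le_div_iff₀ (by positivity)]
  linarith

theorem setIntegral_closedBall_eq_comp_add {d : ℕ} (f : Euc d → ℝ) (x : Euc d) (t : ℝ) :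
    (∫ u in Metric.closedBall x t, f u) = ∫ v in Metric.closedBall 0 t, f (x + v) := by
  have := (measurePreserving_add_left (volume : Measure (Euc d)) x).setIntegral_preimage_emb
    (measurableEmbedding_addLeft x) f (Metric.closedBall x t)
  rw [← this]
  congr 2
  ext v
  simp [dist_eq_norm]

theorem setIntegral_closedBall_eq_comp_sub {d : ℕ} (f : Euc d → ℝ) (x : Euc d) (t : ℝ) :
    (∫ u in Metric.closedBall x t, f u) = ∫ v in Metric.closedBall 0 t, f (x - v) := by
  have := (Measure.measurePreserving_sub_left (volume : Measure (Euc d)) x).setIntegral_preimage_emb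
    (MeasurableEquiv.subLeft x).measurableEmbedding f (Metric.closedBall x t)
  rw [← this]
  congr 2
  ext v
  simp [dist_eq_norm]

theorem sub_le_ballAvg {d : ℕ} (hd : 1 ≤ d) {s L : ℝ} (hs : 0 < s) (hL : 0 < L) {f : Euc d → ℝ}
    (hf : IsHolderOrder d s L f) (x : Euc d) {t : ℝ} (ht : 0 < t) :
    f x - L * t ^ s ≤ ballAvg d f t x := by
  have hc := hf.continuous hs
  have hV := unitBallVol_pos d
  have hp : IntegrableOn (fun v => f (x + v)) (Metric.closedBall 0 t) :=
    integrableOn_closedBall_of_continuous (by fun_prop) 0 t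
  have hm : IntegrableOn (fun v => f (x - v)) (Metric.closedBall 0 t) :=
    integrableOn_closedBall_of_continuous (by fun_prop) 0 t
  have h1 : (∫ _ in Metric.closedBall (0 : Euc d) t, (2 * f x - 2 * (L * t ^ s)))
      ≤ ∫ v in Metric.closedBall (0 : Euc d) t, (f (x + v) + f (x - v)) := by
    refine setIntegral_mono_on (integrableOn_closedBall_of_continuous continuous_const 0 t)
      (hp.add hm) measurableSet_closedBall fun v hv => ?_
    refine le_trans ?_ (two_mul_sub_le_add_of_isHolderOrder hL hf x v)
    have : ‖v‖ ≤ t := by simpa using hv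
    gcongr
  rw [setIntegral_const, volume_real_closedBall_eq hd 0 ht.le, smul_eq_mul,
    integral_add hp hm, ← setIntegral_closedBall_eq_comp_add,
    ← setIntegral_closedBall_eq_comp_sub] at h1
  rw [ballAvg, one_div_mul_eq_div, le_div_iff₀ (by positivity)]
  linarith

theorem ballAvg_mul_le {d : ℕ} {f : Euc d → ℝ} (hf : Continuous f) (h0 : ∀ x, 0 ≤ f x)
    (x : Euc d) {r t : ℝ} (hr : 0 < r) (hrt : r ≤ t) :
    ballAvg d f r x * (r / t) ^ d ≤ ballAvg d f t x := by
  have hV := unitBallVol_pos d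
  have ht : 0 < t := hr.trans_le hrt
  have h1 : (∫ u in Metric.closedBall x r, f u) ≤ ∫ u in Metric.closedBall x t, f u :=
    setIntegral_mono_set (integrableOn_closedBall_of_continuous hf x t)
      (Filter.Eventually.of_forall h0)
      (Metric.closedBall_subset_closedBall hrt).eventuallyLE
  have h2 : ballAvg d f r x * (r / t) ^ d
      = (1 / (unitBallVol d * t ^ d)) * ∫ u in Metric.closedBall x r, f u := by
    rw [ballAvg, div_pow]
    field_simp
  rw [h2, ballAvg]
  gcongr

/-- Pointwise control of the logarithmic ratio below the radius `r` on which `f` is at least half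
of `f x`. -/
theorem log_div_ballAvg_le_of_le {d : ℕ} (hd : 1 ≤ d) {s L : ℝ} (hs : 0 < s) (hL : 0 < L)
    {f : Euc d → ℝ} (hf : IsHolderOrder d s L f) {x : Euc d} (hx : 0 < f x) {t : ℝ} (ht : 0 < t)
    (h : ∀ y, ‖y - x‖ ≤ t → f x / 2 ≤ f y) :
    Real.log (f x / ballAvg d f t x) ≤ min 1 (2 * L * t ^ s / f x) := by
  have h1 := le_ballAvg_of_le hd (hf.continuous hs) ht h
  have h2 := sub_le_ballAvg hd hs hL hf x ht
  set g := ballAvg d f t x with hg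
  have hg0 : 0 < g := by linarith
  have h3 : Real.log (f x / g) ≤ (f x - g) / g := by
    have := Real.log_le_sub_one_of_pos (div_pos hx hg0)
    rwa [sub_div, div_self hg0.ne']
  refine le_min (h3.trans ?_) (h3.trans ?_)
  · rw [div_le_one hg0]
    linarith
  · rw [div_le_div_iff₀ hg0 hx]
    have : 0 ≤ L * t ^ s := by positivity
    nlinarith

theorem log_div_ballAvg_le_of_ge {d : ℕ} (hd : 1 ≤ d) {f : Euc d → ℝ} (hf : Continuous f)
    (h0 : ∀ x, 0 ≤ f x) {x : Euc d} (hx : 0 < f x) {r t : ℝ} (hr : 0 < r) (hrt : r ≤ t)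
    (h : ∀ y, ‖y - x‖ ≤ r → f x / 2 ≤ f y) :
    Real.log (f x / ballAvg d f t x) ≤ 1 + d * Real.log (t / r) := by
  have ht : 0 < t := hr.trans_le hrt
  have h1 := le_ballAvg_of_le hd hf hr h
  have h2 := ballAvg_mul_le hf h0 x hr hrt
  have h3 : f x / 2 * (r / t) ^ d ≤ ballAvg d f t x := le_trans (by gcongr) h2
  have h4 : f x / ballAvg d f t x ≤ 2 * (t / r) ^ d := by
    rw [div_le_iff₀ (lt_of_lt_of_le (by positivity) h3)]
    calc f x = 2 * (t / r) ^ d * (f x / 2 * (r / t) ^ d) := by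
          rw [div_pow, div_pow]
          field_simp
      _ ≤ _ := by gcongr
  have hg0 : 0 < ballAvg d f t x := lt_of_lt_of_le (by positivity) h3
  calc Real.log (f x / ballAvg d f t x) ≤ Real.log (2 * (t / r) ^ d) :=
        Real.log_le_log (by positivity) h4
    _ = Real.log 2 + d * Real.log (t / r) := by
        rw [Real.log_mul (by norm_num) (by positivity), Real.log_pow]
    _ ≤ 1 + d * Real.log (t / r) := by linarith [Real.log_two_lt_d9]

theorem kthSmallest_mem {m : Multiset ℝ} {k : ℕ} (hk : 1 ≤ k) (hkm : k ≤ m.card) :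
    kthSmallest m k ∈ m := by
  have hlt : k - 1 < (m.sort (· ≤ ·)).length := by
    rw [Multiset.length_sort]
    omega
  rw [kthSmallest, List.getD_eq_getElem _ _ hlt, ← Multiset.mem_sort (· ≤ ·)]
  exact List.getElem_mem hlt

theorem countP_lt_of_lt_kthSmallest {m : Multiset ℝ} {k : ℕ} (hk : 1 ≤ k) (hkm : k ≤ m.card)
    {u : ℝ} (hu : u < kthSmallest m k) : m.countP (· ≤ u) < k := by
  have hlt : k - 1 < (m.sort (· ≤ ·)).length := by
    rw [Multiset.length_sort]
    omega
  rw [kthSmallest, List.getD_eq_getElem _ _ hlt] at hu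
  set l := m.sort (· ≤ ·) with hl
  have hpair : l.Pairwise (· ≤ ·) := Multiset.pairwise_sort _ _
  have hdrop : (l.drop (k - 1)).countP (fun a => decide (a ≤ u)) = 0 := by
    rw [List.countP_eq_zero]
    intro a ha
    obtain ⟨i, hi, rfl⟩ := List.mem_iff_getElem.1 ha
    rw [List.length_drop] at hi
    have : l[k - 1] ≤ l[k - 1 + i] :=
      hpair.sortedLE.getElem_le_getElem_of_le (by omega)
    simp only [List.getElem_drop, decide_eq_true_eq, not_le]
    exact hu.trans_le this
  have h1 : m.countP (· ≤ u) = l.countP (fun a => decide (a ≤ u)) := by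
    rw [← Multiset.coe_countP, hl, Multiset.sort_eq]
  rw [h1, ← List.take_append_drop (k - 1) l, List.countP_append, hdrop, add_zero]
  refine (List.countP_le_length).trans_lt ?_
  rw [List.length_take]
  omega

theorem card_filter_lt_of_lt_RkOfPoint {d n k : ℕ} (hk : 1 ≤ k) (hkn : k ≤ n) {x : Euc d}
    {X : Fin n → Euc d} {u : ℝ} (hu : u < RkOfPoint d n k x X) :
    (Finset.univ.filter fun j => torusDist d x (X j) ≤ u).card < k := by
  have := countP_lt_of_lt_kthSmallest hk (by simpa using hkn) hu
  rwa [Multiset.countP_map] at this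

theorem torusDist_nonneg (d : ℕ) (x y : Euc d) : 0 ≤ torusDist d x y :=
  Real.iInf_nonneg fun _ => norm_nonneg _

theorem torusDist_le_norm_add_intVec (d : ℕ) (x y : Euc d) (m : Fin d → ℤ) :
    torusDist d x y ≤ ‖x + intVec d m - y‖ :=
  ciInf_le ⟨0, by rintro _ ⟨_, rfl⟩; exact norm_nonneg _⟩ m

theorem norm_le_sqrt_mul_of_abs_le {d : ℕ} {v : Euc d} {h : ℝ} (hh : 0 ≤ h)
    (hv : ∀ i, |v i| ≤ h) : ‖v‖ ≤ √d * h := by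
  rw [EuclideanSpace.norm_eq]
  refine Real.sqrt_le_iff.2 ⟨by positivity, ?_⟩
  rw [mul_pow, Real.sq_sqrt (by positivity)]
  calc ∑ i, ‖v i‖ ^ 2 ≤ ∑ _i : Fin d, h ^ 2 := by
        gcongr with i
        exact hv i
    _ = d * h ^ 2 := by simp

theorem torusDist_le_norm_sub (d : ℕ) (x y : Euc d) : torusDist d x y ≤ ‖y - x‖ := by
  have h0 : intVec d 0 = 0 := by
    ext i
    simp [intVec]
  have := torusDist_le_norm_add_intVec d x y 0
  rwa [h0, add_zero, norm_sub_rev] at this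

theorem torusDist_le_sqrt (d : ℕ) (x y : Euc d) : torusDist d x y ≤ √d := by
  refine (torusDist_le_norm_add_intVec d x y fun i => round (y i - x i)).trans ?_
  have := norm_le_sqrt_mul_of_abs_le (v := x + intVec d (fun i => round (y i - x i)) - y)
    (zero_le_one) (fun i => by
      have h1 := abs_sub_round (y i - x i)
      have h2 : (x + intVec d (fun i => round (y i - x i)) - y) i
          = -((y i - x i) - round (y i - x i)) := by
        simp [intVec]
        ring
      rw [h2, abs_neg]
      linarith)
  simpa using this

theorem RkOfPoint_mem_range {d n k : ℕ} (hk : 1 ≤ k) (hkn : k ≤ n) (x : Euc d)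
    (X : Fin n → Euc d) : ∃ j, torusDist d x (X j) = RkOfPoint d n k x X := by
  have := kthSmallest_mem (m := Finset.univ.val.map fun j : Fin n => torusDist d x (X j)) hk
    (by simpa using hkn)
  obtain ⟨j, -, hj⟩ := Multiset.mem_map.1 this
  exact ⟨j, hj⟩

/-- The axis-parallel cube with lowest corner `a` and side `h`. -/
def cornerCube (d : ℕ) (a : Fin d → ℝ) (h : ℝ) : Set (Euc d) :=
  {y | ∀ i, y i ∈ Set.Icc (a i) (a i + h)}

theorem cornerCube_eq_preimage (d : ℕ) (a : Fin d → ℝ) (h : ℝ) :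
    cornerCube d a h = (MeasurableEquiv.toLp 2 (Fin d → ℝ)).symm ⁻¹'
      Set.univ.pi fun i => Set.Icc (a i) (a i + h) := by
  ext y
  simp [cornerCube, -Set.pi_univ_Icc]

theorem measurableSet_cornerCube (d : ℕ) (a : Fin d → ℝ) (h : ℝ) :
    MeasurableSet (cornerCube d a h) := by
  rw [cornerCube_eq_preimage]
  exact (MeasurableEquiv.measurable _) (MeasurableSet.univ_pi fun _ => measurableSet_Icc)

theorem volume_cornerCube (d : ℕ) (a : Fin d → ℝ) {h : ℝ} (hh : 0 ≤ h) :
    volume (cornerCube d a h) = ENNReal.ofReal (h ^ d) := by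
  rw [cornerCube_eq_preimage,
    (EuclideanSpace.volume_preserving_symm_measurableEquiv_toLp (Fin d)).measure_preimage_equiv,
    volume_pi_pi]
  simp [ENNReal.ofReal_pow hh]

theorem unitCube_eq_cornerCube (d : ℕ) : unitCube d = cornerCube d 0 1 := by
  simp [unitCube, cornerCube]

theorem measurableSet_unitCube (d : ℕ) : MeasurableSet (unitCube d) := by
  rw [unitCube_eq_cornerCube]
  exact measurableSet_cornerCube d 0 1

theorem volume_unitCube (d : ℕ) : volume (unitCube d) = 1 := by
  rw [unitCube_eq_cornerCube, volume_cornerCube d 0 zero_le_one]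
  simp

theorem norm_sub_le_sqrt_of_mem_unitCube {d : ℕ} {x y : Euc d} (hx : x ∈ unitCube d)
    (hy : y ∈ unitCube d) : ‖y - x‖ ≤ √d := by
  have := norm_le_sqrt_mul_of_abs_le (v := y - x) zero_le_one fun i => by
    have h1 := hx i
    have h2 := hy i
    rw [PiLp.sub_apply, abs_le]
    constructor <;> linarith [h1.1, h1.2, h2.1, h2.2]
  simpa using this

theorem exists_cornerCube_subset {d : ℕ} {x : Euc d} (hx : x ∈ unitCube d) {h : ℝ} (hh : 0 ≤ h)
    (hh2 : h ≤ 1 / 2) :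
    ∃ a, cornerCube d a h ⊆ unitCube d ∧ ∀ y ∈ cornerCube d a h, ‖y - x‖ ≤ √d * h := by
  refine ⟨fun i => if x i ≤ 1 / 2 then x i else x i - h, fun y hy i => ?_, fun y hy => ?_⟩
  · have h1 := hx i
    have h2 := hy i
    simp only at h2
    split_ifs at h2 <;> constructor <;> linarith [h1.1, h1.2, h2.1, h2.2]
  · refine norm_le_sqrt_mul_of_abs_le hh fun i => ?_
    have h2 := hy i
    simp only at h2
    rw [PiLp.sub_apply, abs_le]
    split_ifs at h2 <;> constructor <;> linarith [h2.1, h2.2]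

theorem isProbabilityMeasure_densityMeasure {d : ℕ} {f : Euc d → ℝ} (h0 : ∀ x, 0 ≤ f x)
    (h1 : (∫ x in unitCube d, f x) = 1) : IsProbabilityMeasure (densityMeasure d f) := by
  have hi : IntegrableOn f (unitCube d) := by
    by_contra h
    rw [integral_undef h] at h1
    exact zero_ne_one h1
  constructor
  rw [densityMeasure, withDensity_apply _ MeasurableSet.univ, Measure.restrict_univ,
    ← ofReal_integral_eq_lintegral_ofReal hi (Filter.Eventually.of_forall h0), h1,
    ENNReal.ofReal_one]

theorem le_densityMeasure_cornerCube {d : ℕ} {f : Euc d → ℝ} {a : Fin d → ℝ} {h m : ℝ}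
    (hh : 0 ≤ h) (hm : 0 ≤ m) (hsub : cornerCube d a h ⊆ unitCube d)
    (hf : ∀ y ∈ cornerCube d a h, m ≤ f y) :
    ENNReal.ofReal (m * h ^ d) ≤ densityMeasure d f (cornerCube d a h) := by
  have hQ := measurableSet_cornerCube d a h
  rw [densityMeasure, withDensity_apply _ hQ, Measure.restrict_restrict hQ,
    Set.inter_eq_left.2 hsub, ENNReal.ofReal_mul hm, ← volume_cornerCube d a hh,
    ← setLIntegral_const]
  exact setLIntegral_mono' hQ fun y hy => ENNReal.ofReal_le_ofReal (hf y hy)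

theorem le_of_le_on_unitCube {d : ℕ} {f : Euc d → ℝ} {m : ℝ} (h1 : (∫ x in unitCube d, f x) = 1)
    (hf : ∀ y ∈ unitCube d, m ≤ f y) : m ≤ 1 := by
  have hi : IntegrableOn f (unitCube d) := by
    by_contra h
    rw [integral_undef h] at h1
    exact zero_ne_one h1
  have hv : volume.real (unitCube d) = 1 := by simp [measureReal_def, volume_unitCube]
  have := setIntegral_mono_on (integrableOn_const (by simp [volume_unitCube])) hi
    (measurableSet_unitCube d) hf
  rwa [setIntegral_const, hv, h1, one_smul] at this

/-- Uniform bound on the density, and uniform radius of comparability, over the Hölder ball. -/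
theorem exists_uniform_radius {d : ℕ} {s L : ℝ} (hs : 0 < s) (hL : 0 < L) :
    ∃ c M : ℝ, 0 < c ∧ c ≤ 1 ∧ 0 < M ∧ ∀ f : Euc d → ℝ, HolderDensity d s L f →
      ∀ x ∈ unitCube d, f x ≤ M ∧ c * f x ^ (1 / s) ≤ 1 / 2 ∧
        ∀ y, ‖y - x‖ ≤ c * f x ^ (1 / s) → f x / 2 ≤ f y := by
  obtain ⟨c, hc, hc1, H⟩ := exists_half_le_of_nonneg hs hL
  set M : ℝ := max 2 ((√d / c) ^ s) with hM
  have hM0 : 0 < M := lt_max_of_lt_left two_pos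
  have hc' : min c (1 / (2 * M ^ (1 / s))) ≤ c := min_le_left _ _
  refine ⟨min c (1 / (2 * M ^ (1 / s))), M, by positivity, hc'.trans hc1, hM0, fun f hf x hx => ?_⟩
  obtain ⟨hf, -, h0, h1⟩ := hf
  have hfM : f x ≤ M := by
    by_contra! hlt
    have hx2 : (√d / c) ^ s ≤ f x := (le_max_right _ _).trans hlt.le
    have hx3 : √d ≤ c * f x ^ (1 / s) := by
      have := Real.rpow_le_rpow (by positivity) hx2 (one_div_pos.2 hs).le
      rwa [← Real.rpow_mul (by positivity), mul_one_div_cancel hs.ne', Real.rpow_one,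
        div_le_iff₀' hc] at this
    have := le_of_le_on_unitCube h1 fun y hy =>
      H d f hf h0 x y ((norm_sub_le_sqrt_of_mem_unitCube hx hy).trans hx3)
    have : 2 ≤ M := le_max_left _ _
    linarith
  have hpow : f x ^ (1 / s) ≤ M ^ (1 / s) := Real.rpow_le_rpow (h0 x) hfM (one_div_pos.2 hs).le
  have hf0 : 0 ≤ f x ^ (1 / s) := Real.rpow_nonneg (h0 x) _
  refine ⟨hfM, ?_, fun y hy => H d f hf h0 x y (hy.trans (by gcongr))⟩
  calc min c (1 / (2 * M ^ (1 / s))) * f x ^ (1 / s)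
      ≤ 1 / (2 * M ^ (1 / s)) * M ^ (1 / s) := by
        gcongr
        exact min_le_right _ _
    _ = 1 / 2 := by field_simp

/-- The weight of a sample point: `1 / 2` on `Q` and `1` off `Q`. -/
noncomputable def hitWeight {d : ℕ} (Q : Set (Euc d)) (y : Euc d) : ℝ :=
  1 - Q.indicator (fun _ => (1 / 2 : ℝ)) y

theorem one_le_two_pow_mul_prod_hitWeight {d n k : ℕ} (hk : 1 ≤ k) (hkn : k ≤ n) {x : Euc d}
    {X : Fin n → Euc d} {u : ℝ} {Q : Set (Euc d)} (hQ : ∀ y ∈ Q, torusDist d x y ≤ u)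
    (hu : u < RkOfPoint d n k x X) : 1 ≤ 2 ^ k * ∏ j, hitWeight Q (X j) := by
  classical
  have hw : ∀ y, hitWeight Q y = if y ∈ Q then (1 / 2 : ℝ) else 1 := by
    intro y
    by_cases h : y ∈ Q <;> norm_num [hitWeight, h]
  have hcard : (Finset.univ.filter fun j => X j ∈ Q).card ≤ k :=
    (Finset.card_le_card (Finset.monotone_filter_right _ fun j _ hj => hQ _ hj)).trans
      (card_filter_lt_of_lt_RkOfPoint hk hkn hu).le
  simp only [hw]
  rw [Finset.prod_ite, Finset.prod_const, Finset.prod_const_one, mul_one]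
  calc (1 : ℝ) = 2 ^ k * (1 / 2) ^ k := by rw [← mul_pow]; norm_num
    _ ≤ _ := by
      gcongr 2 ^ k * ?_
      exact pow_le_pow_of_le_one (by norm_num) (by norm_num) hcard

theorem hitWeight_nonneg {d : ℕ} (Q : Set (Euc d)) (y : Euc d) : 0 ≤ hitWeight Q y := by
  by_cases h : y ∈ Q <;> norm_num [hitWeight, h]

theorem hitWeight_le_one {d : ℕ} (Q : Set (Euc d)) (y : Euc d) : hitWeight Q y ≤ 1 := by
  by_cases h : y ∈ Q <;> norm_num [hitWeight, h]

theorem measurable_hitWeight {d : ℕ} {Q : Set (Euc d)} (hQ : MeasurableSet Q) :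
    Measurable (hitWeight Q) :=
  measurable_const.sub (measurable_const.indicator hQ)

theorem integrable_prod_hitWeight {d n : ℕ} (μ : Measure (Euc d)) [IsProbabilityMeasure μ]
    {Q : Set (Euc d)} (hQ : MeasurableSet Q) :
    Integrable (fun X : Fin n → Euc d => ∏ j, hitWeight Q (X j)) (Measure.pi fun _ => μ) := by
  refine Integrable.of_bound (C := 1) (Measurable.aestronglyMeasurable ?_)
    (Filter.Eventually.of_forall fun X => ?_)
  · exact Finset.measurable_prod _ fun j _ => (measurable_hitWeight hQ).comp (measurable_pi_apply j)
  · rw [Real.norm_of_nonneg (Finset.prod_nonneg fun j _ => hitWeight_nonneg Q _)]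
    exact Finset.prod_le_one (fun j _ => hitWeight_nonneg Q _) fun j _ => hitWeight_le_one Q _

theorem integral_prod_hitWeight_le {d n : ℕ} (μ : Measure (Euc d)) [IsProbabilityMeasure μ]
    {Q : Set (Euc d)} (hQ : MeasurableSet Q) {q : ℝ} (hq : ENNReal.ofReal q ≤ μ Q) :
    ∫ X : Fin n → Euc d, ∏ j, hitWeight Q (X j) ∂(Measure.pi fun _ => μ)
      ≤ Real.exp (-(n * (q / 2))) := by
  have hq' : q ≤ μ.real Q := by
    rw [measureReal_def]
    exact (ENNReal.ofReal_le_iff_le_toReal (measure_ne_top μ Q)).1 hq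
  have h1 : ∫ y, hitWeight Q y ∂μ = 1 - μ.real Q / 2 := by
    simp only [hitWeight]
    rw [integral_sub (integrable_const _) ((integrable_const _).indicator hQ),
      integral_indicator_const _ hQ]
    simp [div_eq_mul_inv]
  rw [integral_fintype_prod_eq_pow (hitWeight Q), h1, Fintype.card_fin]
  have h2 : 0 ≤ 1 - μ.real Q / 2 := by
    have : μ.real Q ≤ 1 := measureReal_le_one
    linarith
  calc (1 - μ.real Q / 2) ^ n ≤ (Real.exp (-(q / 2))) ^ n := by
        gcongr
        linarith [Real.one_sub_le_exp_neg (q / 2)]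
    _ = Real.exp (-(n * (q / 2))) := by
        rw [← Real.exp_nat_mul]
        congr 1
        ring

theorem lintegral_ofReal_le_of_RkOfPoint {d n k : ℕ} (hk : 1 ≤ k) (hkn : k ≤ n)
    (μ : Measure (Euc d)) [IsProbabilityMeasure μ] {x : Euc d} {u q A W : ℝ} {Q : Set (Euc d)}
    (hQm : MeasurableSet Q) (hQ : ∀ y ∈ Q, torusDist d x y ≤ u) (hq : ENNReal.ofReal q ≤ μ Q)
    (hA : 0 ≤ A) (hW : 0 ≤ W) {G : (Fin n → Euc d) → ℝ}
    (hGA : ∀ X, RkOfPoint d n k x X ≤ u → G X ≤ A)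
    (hGW : ∀ X, u < RkOfPoint d n k x X → G X ≤ W) :
    ∫⁻ X, ENNReal.ofReal (G X) ∂(Measure.pi fun _ => μ)
      ≤ ENNReal.ofReal (A + W * (2 ^ k * Real.exp (-(n * (q / 2))))) := by
  have hP : ∀ X : Fin n → Euc d, 0 ≤ ∏ j, hitWeight Q (X j) := fun X =>
    Finset.prod_nonneg fun j _ => hitWeight_nonneg Q _
  have hG : ∀ X, G X ≤ A + W * (2 ^ k * ∏ j, hitWeight Q (X j)) := by
    intro X
    have hPX := hP X
    rcases le_or_gt (RkOfPoint d n k x X) u with h | h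
    · have : 0 ≤ W * (2 ^ k * ∏ j, hitWeight Q (X j)) := by positivity
      linarith [hGA X h]
    · have := le_mul_of_one_le_right hW (one_le_two_pow_mul_prod_hitWeight hk hkn hQ h)
      linarith [hGW X h]
  have hint := (((integrable_prod_hitWeight (n := n) μ hQm).const_mul (2 ^ k)).const_mul W)
  calc ∫⁻ X, ENNReal.ofReal (G X) ∂(Measure.pi fun _ => μ)
      ≤ ∫⁻ X : Fin n → Euc d, ENNReal.ofReal (A + W * (2 ^ k * ∏ j, hitWeight Q (X j)))
          ∂(Measure.pi fun _ => μ) :=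
        lintegral_mono fun X => ENNReal.ofReal_le_ofReal (hG X)
    _ = ENNReal.ofReal (∫ X : Fin n → Euc d, (A + W * (2 ^ k * ∏ j, hitWeight Q (X j)))
          ∂(Measure.pi fun _ => μ)) := by
        refine (ofReal_integral_eq_lintegral_ofReal ((integrable_const A).add hint)
          (Filter.Eventually.of_forall fun X => ?_)).symm
        have := hP X
        exact add_nonneg hA (by positivity)
    _ ≤ _ := by
        refine ENNReal.ofReal_le_ofReal ?_
        rw [integral_add (integrable_const A) hint, integral_const_mul, integral_const_mul]
        simp only [integral_const, probReal_univ, one_smul]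
        gcongr
        exact integral_prod_hitWeight_le μ hQm hq

theorem RkOfPoint_nonneg {d n k : ℕ} (hk : 1 ≤ k) (hkn : k ≤ n) (x : Euc d) (X : Fin n → Euc d) :
    0 ≤ RkOfPoint d n k x X := by
  obtain ⟨j, hj⟩ := RkOfPoint_mem_range hk hkn x X
  exact hj ▸ torusDist_nonneg d x (X j)

theorem RkOfPoint_le_sqrt {d n k : ℕ} (hk : 1 ≤ k) (hkn : k ≤ n) (x : Euc d)
    (X : Fin n → Euc d) : RkOfPoint d n k x X ≤ √d := by
  obtain ⟨j, hj⟩ := RkOfPoint_mem_range hk hkn x X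
  exact hj ▸ torusDist_le_sqrt d x (X j)

/-- Expected logarithmic ratio at a fixed point `x` with `0 < f x`, for any truncation radius `u`
below the radius `r` of comparability. -/
theorem lintegral_log_div_ballAvg_le {d n k : ℕ} (hd : 1 ≤ d) (hk : 1 ≤ k) (hkn : k ≤ n)
    {s L : ℝ} (hs : 0 < s) (hL : 0 < L) {f : Euc d → ℝ} (hf : HolderDensity d s L f) {x : Euc d}
    (hxc : x ∈ unitCube d) (hx : 0 < f x) {u r : ℝ} (hu : 0 < u) (hur : u ≤ r) (hr : r ≤ 1 / 2)
    (h : ∀ y, ‖y - x‖ ≤ r → f x / 2 ≤ f y) :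
    ∫⁻ X, ENNReal.ofReal (Real.log (f x / ballAvg d f (RkOfPoint d n k x X) x))
        ∂(sampleMeasure d n f)
      ≤ ENNReal.ofReal (min 1 (2 * L * u ^ s / f x) + (1 + d * Real.log (√d / r)) *
          (2 ^ k * Real.exp (-(n * (f x / 2 * (u / √d) ^ d / 2))))) := by
  obtain ⟨hf, -, h0, h1⟩ := hf
  have := isProbabilityMeasure_densityMeasure h0 h1
  have hr0 : 0 < r := hu.trans_le hur
  have hD : 1 ≤ √(d : ℝ) := Real.one_le_sqrt.2 (by exact_mod_cast hd)
  obtain ⟨a, hsub, hdist⟩ := exists_cornerCube_subset hxc (h := u / √d) (by positivity)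
    ((div_le_self hu.le hD).trans (hur.trans hr))
  have hdist' : ∀ y ∈ cornerCube d a (u / √d), ‖y - x‖ ≤ u := fun y hy => by
    have := hdist y hy
    rwa [mul_div_cancel₀ _ (by positivity)] at this
  have hlog : 0 ≤ Real.log (√d / r) := Real.log_nonneg (by rw [le_div_iff₀ hr0]; linarith)
  have hmono : ∀ {t : ℝ}, 0 < t → t ≤ r →
      Real.log (f x / ballAvg d f t x) ≤ min 1 (2 * L * t ^ s / f x) := fun ht htr =>
    log_div_ballAvg_le_of_le hd hs hL hf hx ht fun y hy => h y (hy.trans htr)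
  refine lintegral_ofReal_le_of_RkOfPoint hk hkn (densityMeasure d f)
    (measurableSet_cornerCube d a (u / √d))
    (fun y hy => (torusDist_le_norm_sub d x y).trans (hdist' y hy))
    (le_densityMeasure_cornerCube (by positivity) (by positivity) hsub fun y hy =>
      h y ((hdist' y hy).trans hur)) (by positivity) (by positivity) (fun X hX => ?_)
    fun X hX => ?_
  · rcases (RkOfPoint_nonneg hk hkn x X).eq_or_lt with ht | ht
    · rw [← ht, ballAvg, zero_pow (by omega), mul_zero, div_zero, zero_mul, div_zero, Real.log_zero]
      positivity
    · refine (hmono ht (hX.trans hur)).trans ?_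
      gcongr
  · have ht : 0 < RkOfPoint d n k x X := hu.trans hX
    rcases le_or_gt (RkOfPoint d n k x X) r with hR | hR
    · have h2 := (hmono ht hR).trans (min_le_left _ _)
      have : 0 ≤ d * Real.log (√d / r) := by positivity
      linarith
    · refine (log_div_ballAvg_le_of_ge hd (hf.continuous hs) h0 hx hr0 hR.le h).trans ?_
      have := RkOfPoint_le_sqrt hk hkn x X
      gcongr

theorem mul_rpow_neg_div_add_eq {N s d : ℝ} (hN : 1 ≤ N) (hs : 0 < s) (hd : 0 < d) :
    N * N ^ (-(s / (s + d))) * (N ^ (-(s / (s + d)))) ^ (d / s) = 1 := by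
  have hN0 : 0 < N := by linarith
  rw [← Real.rpow_mul hN0.le, ← Real.rpow_one_add' hN0.le (by
    have : s / (s + d) < 1 := by rw [div_lt_one (by positivity)]; linarith
    linarith), ← Real.rpow_add hN0]
  rw [show 1 + -(s / (s + d)) + -(s / (s + d)) * (d / s) = 0 by field_simp; ring, Real.rpow_zero]

theorem add_mul_neg_log_le_of_ge {y F K a l : ℝ} (hF : 0 < F) (hK : 0 ≤ K) (ha : 0 ≤ a)
    (hl : 1 ≤ 2 * l) (hlogF : -Real.log F ≤ l) (h : F ≤ y) :
    K + a * (-Real.log y) ≤ (2 * K + 3 * a) * l := by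
  have h1 : -Real.log y ≤ l := by linarith [Real.log_le_log hF h]
  have h2 : a * (-Real.log y) ≤ a * l := by gcongr
  nlinarith

theorem mul_add_mul_neg_log_le_of_le {y F K a l : ℝ} (hy : 0 < y) (hK : 0 ≤ K) (ha : 0 ≤ a)
    (hl : 1 ≤ 2 * l) (hlogF : -Real.log F ≤ l) (h : y ≤ F) :
    y * (K + a * (-Real.log y)) ≤ (2 * K + 3 * a) * F * l := by
  have hF : 0 < F := hy.trans_le h
  have h1 : Real.log (F / y) ≤ F / y := by
    linarith [Real.log_le_sub_one_of_pos (div_pos hF hy)]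
  rw [Real.log_div hF.ne' hy.ne', le_div_iff₀ hy] at h1
  have h2 : y * (-Real.log F) ≤ F * l :=
    (mul_le_mul_of_nonneg_left hlogF hy.le).trans (by gcongr; linarith)
  have h3 : y * (-Real.log y) ≤ 3 * (F * l) := by nlinarith
  have h4 : y * K ≤ 2 * K * (F * l) := by
    have : y * K ≤ F * K := by gcongr
    have : F * K * 1 ≤ F * K * (2 * l) := by gcongr
    linarith
  have h5 : a * (y * (-Real.log y)) ≤ a * (3 * (F * l)) := by gcongr
  linarith

theorem le_mul_mul_rpow_of_mul_le {N F a y z : ℝ} (hN : 0 ≤ N) (hF : 0 < F) (ha : 0 ≤ a)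
    (hNF : N * F * F ^ a = 1) (hz : 1 ≤ z) (hzy : F * z ≤ y) : z ≤ N * (y * y ^ a) := by
  have hz0 : 0 < z := by linarith
  have hy : 0 ≤ y := le_trans (by positivity) hzy
  calc z ≤ z * z ^ a := le_mul_of_one_le_right hz0.le (Real.one_le_rpow hz ha)
    _ = N * F * F ^ a * (z * z ^ a) := by rw [hNF, one_mul]
    _ = N * ((F * z) * (F * z) ^ a) := by
        rw [Real.mul_rpow hF.le hz0.le]
        ring
    _ ≤ _ := by gcongr

set_option maxHeartbeats 1000000 in
/-- Optimisation of the truncation radius: with `F = n ^ (-(s / (s + d)))` the truncated bound is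
`O(F log (n + 1))` uniformly in the value `y` of the density. -/
theorem exists_truncation_radius {d : ℕ} (k : ℕ) (hd : 1 ≤ d) {s L c M : ℝ} (hs : 0 < s)
    (hL : 0 < L) (hc : 0 < c) (hc1 : c ≤ 1) (hM : 0 < M) :
    ∃ C : ℝ, 0 < C ∧ ∀ n : ℕ, 1 ≤ n → ∀ y : ℝ, 0 < y → y ≤ M → c * y ^ (1 / s) ≤ 1 / 2 →
      ∃ u, 0 < u ∧ u ≤ c * y ^ (1 / s) ∧
        y * (min 1 (2 * L * u ^ s / y) + (1 + d * Real.log (√d / (c * y ^ (1 / s)))) *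
          (2 ^ k * Real.exp (-(n * (y / 2 * (u / √d) ^ d / 2)))))
        ≤ C * (n : ℝ) ^ (-(s / (s + d))) * Real.log (n + 1) := by
  have hD : 1 ≤ √(d : ℝ) := Real.one_le_sqrt.2 (by exact_mod_cast hd)
  have hd0 : (0 : ℝ) < d := by exact_mod_cast hd
  set b : ℝ := 1 / (4 * √d ^ d) with hb
  have hb0 : 0 < b := by positivity
  set e : ℝ := b * c ^ d with he
  have he0 : 0 < e := by positivity
  set B : ℝ := 2 + 1 / e with hB
  set K : ℝ := 1 + d * Real.log (√d / c) with hK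
  have hlogDc : 0 ≤ Real.log (√d / c) := Real.log_nonneg (by rw [le_div_iff₀ hc]; linarith)
  have hK0 : 0 < K := by positivity
  set K₂ : ℝ := 2 * K + 3 * (d / s) with hK₂
  have hK₂0 : 0 < K₂ := by positivity
  refine ⟨4 * L + M * K₂ * 2 ^ k + B + K₂ * 2 ^ k / e + K₂ * 2 ^ k, by positivity,
    fun n hn y hy hyM hr => ?_⟩
  have hN : (1 : ℝ) ≤ n := by exact_mod_cast hn
  have hN0 : (0 : ℝ) < n := by linarith
  set F : ℝ := (n : ℝ) ^ (-(s / (s + d))) with hF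
  set l : ℝ := Real.log (n + 1) with hl
  have hF0 : 0 < F := by positivity
  have hNF : n * F * F ^ (d / s : ℝ) = 1 := mul_rpow_neg_div_add_eq hN hs hd0
  have hα : s / (s + d) ≤ 1 := by
    rw [div_le_one (by positivity)]
    linarith
  have hinv : 1 / (n : ℝ) ≤ F := by
    rw [hF, one_div, ← Real.rpow_neg_one]
    exact Real.rpow_le_rpow_of_exponent_le hN (by linarith)
  have hl1 : 1 ≤ 2 * l := by
    have : Real.log 2 ≤ l := Real.log_le_log two_pos (by linarith)
    linarith [Real.log_two_gt_d9]
  have hl0 : 0 < l := by linarith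
  have hlogF : -Real.log F ≤ l := by
    have h1 : Real.log n ≤ l := Real.log_le_log hN0 (by linarith)
    have h2 : 0 ≤ Real.log n := Real.log_nonneg hN
    rw [hF, Real.log_rpow hN0]
    nlinarith
  set W : ℝ := 1 + d * Real.log (√d / (c * y ^ (1 / s))) with hW
  have hyp : 0 < y ^ (1 / s) := by positivity
  have hW0 : 0 ≤ W := by
    have : 0 ≤ Real.log (√d / (c * y ^ (1 / s))) :=
      Real.log_nonneg (by rw [le_div_iff₀ (by positivity)]; linarith)
    positivity
  have hWK : W = K + d / s * (-Real.log y) := by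
    rw [hW, hK, ← div_div, Real.log_div (x := √d / c) (by positivity) hyp.ne', Real.log_rpow hy]
    field_simp
    ring
  have hds : 0 < (d : ℝ) / s := by positivity
  have hWlarge : F ≤ y → W ≤ K₂ * l := fun h =>
    hWK ▸ add_mul_neg_log_le_of_ge hF0 hK0.le hds.le hl1 hlogF h
  have hWsmall : y ≤ F → y * W ≤ K₂ * F * l := fun h =>
    hWK ▸ mul_add_mul_neg_log_le_of_le hy hK0.le hds.le hl1 hlogF h
  have hgrow : ∀ z, 1 ≤ z → F * z ≤ y → z ≤ n * (y * y ^ (d / s : ℝ)) := fun z hz hzy =>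
    le_mul_mul_rpow_of_mul_le hN0.le hF0 hds.le hNF hz hzy
  have hexp : ∀ u : ℝ, n * (y / 2 * (u / √d) ^ d / 2) = b * (n * y * u ^ d) := by
    intro u
    rw [hb, div_pow]
    field_simp
    ring
  have hrd : (c * y ^ (1 / s)) ^ d = c ^ d * y ^ (d / s : ℝ) := by
    rw [mul_pow, ← Real.rpow_natCast (y ^ (1 / s)), ← Real.rpow_mul hy.le]
    congr 2
    ring
  have hk2 : (0 : ℝ) < 2 ^ k := by positivity
  have hBl : 1 ≤ B * l := by
    have : 0 ≤ 1 / e * l := by positivity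
    rw [hB]
    linarith
  have hFl : 0 < F * l := by positivity
  rcases le_or_gt (F * (B * l)) y with hcase | hcase
  · have hFy : F ≤ y := (le_mul_of_one_le_right hF0.le hBl).trans hcase
    set v : ℝ := l / b / (n * y) with hv
    have hv0 : 0 < v := by positivity
    have hvd : (v ^ (1 / d : ℝ)) ^ d = v := by
      rw [← Real.rpow_natCast, ← Real.rpow_mul hv0.le, one_div_mul_cancel hd0.ne', Real.rpow_one]
    have hBb : l / b ≤ c ^ d * (B * l) := by
      have h1 : c ^ d * (1 / e * l) = l / b := by
        rw [he]
        field_simp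
      have h2 : 0 ≤ c ^ d * (2 * l) := by positivity
      rw [hB]
      linarith
    refine ⟨v ^ (1 / d : ℝ), by positivity, ?_, ?_⟩
    · refine le_of_pow_le_pow_left₀ (n := d) (by omega) (by positivity) ?_
      rw [hvd, hrd, hv, div_le_iff₀ (by positivity)]
      calc l / b ≤ c ^ d * (B * l) := hBb
        _ ≤ c ^ d * (n * (y * y ^ (d / s : ℝ))) := by
          exact mul_le_mul_of_nonneg_left (hgrow _ hBl hcase) (by positivity)
        _ = _ := by ring
    · have hvF : v ≤ F ^ (d / s : ℝ) := by
        have h1 : l / b ≤ B * l :=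
          hBb.trans (mul_le_of_le_one_left (by positivity) (pow_le_one₀ hc.le hc1))
        rw [hv, div_le_iff₀ (by positivity)]
        calc l / b ≤ B * l := h1
          _ = n * F * F ^ (d / s : ℝ) * (B * l) := by rw [hNF, one_mul]
          _ = F ^ (d / s : ℝ) * (n * (F * (B * l))) := by ring
          _ ≤ _ := by gcongr
      have hus : (v ^ (1 / d : ℝ)) ^ s ≤ F := by
        calc (v ^ (1 / d : ℝ)) ^ s ≤ ((F ^ (d / s : ℝ)) ^ (1 / d : ℝ)) ^ s := by gcongr
          _ = F := by
            rw [← Real.rpow_mul hF0.le, ← Real.rpow_mul hF0.le,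
              show (d : ℝ) / s * (1 / d) * s = 1 by field_simp, Real.rpow_one]
      have ht1 : y * min 1 (2 * L * (v ^ (1 / d : ℝ)) ^ s / y) ≤ 4 * L * (F * l) := by
        calc y * min 1 (2 * L * (v ^ (1 / d : ℝ)) ^ s / y)
            ≤ y * (2 * L * (v ^ (1 / d : ℝ)) ^ s / y) := by
              gcongr
              exact min_le_right _ _
          _ = 2 * L * (v ^ (1 / d : ℝ)) ^ s := by field_simp
          _ ≤ 2 * L * F * 1 := by rw [mul_one]; gcongr
          _ ≤ 2 * L * F * (2 * l) := by gcongr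
          _ = _ := by ring
      have hE : Real.exp (-(n * (y / 2 * (v ^ (1 / d : ℝ) / √d) ^ d / 2))) ≤ F := by
        rw [hexp, hvd, hv, show b * (n * y * (l / b / (n * y))) = l by field_simp, Real.exp_neg,
          hl, Real.exp_log (by positivity), ← one_div]
        exact (one_div_le_one_div_of_le hN0 (by linarith)).trans hinv
      have ht2 : y * (W * (2 ^ k * Real.exp (-(n * (y / 2 * (v ^ (1 / d : ℝ) / √d) ^ d / 2)))))
          ≤ M * (K₂ * l * (2 ^ k * F)) := by
        have := hWlarge hFy
        gcongr
      have : 0 ≤ (B + K₂ * 2 ^ k / e + K₂ * 2 ^ k) * (F * l) := by positivity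
      linarith
  · refine ⟨c * y ^ (1 / s), by positivity, le_rfl, ?_⟩
    have ht1 : y * min 1 (2 * L * (c * y ^ (1 / s)) ^ s / y) ≤ B * (F * l) := by
      calc y * min 1 (2 * L * (c * y ^ (1 / s)) ^ s / y) ≤ y * 1 := by
            gcongr
            exact min_le_left _ _
        _ ≤ B * (F * l) := by linarith
    rw [hexp, hrd]
    set E : ℝ := b * (n * y * (c ^ d * y ^ (d / s : ℝ))) with hE
    have hE0 : 0 < E := by positivity
    have ht2 : y * (W * (2 ^ k * Real.exp (-E)))
        ≤ (K₂ * 2 ^ k / e + K₂ * 2 ^ k) * (F * l) := by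
      rcases le_or_gt F y with hFy | hFy
      · have h1 : e * (y / F) ≤ E := by
          calc e * (y / F) ≤ e * (n * (y * y ^ (d / s : ℝ))) := by
                gcongr
                refine hgrow _ ((one_le_div hF0).2 hFy) ?_
                rw [mul_div_cancel₀ _ hF0.ne']
            _ = E := by rw [hE, he]; ring
        have h2 : y * Real.exp (-E) ≤ F / e := by
          have h3 : Real.exp (-E) ≤ 1 / (e * (y / F)) := by
            rw [Real.exp_neg, ← one_div]
            refine one_div_le_one_div_of_le (by positivity) (h1.trans ?_)
            linarith [Real.add_one_le_exp E]
          calc y * Real.exp (-E) ≤ y * (1 / (e * (y / F))) := by gcongr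
            _ = F / e := by field_simp
        calc y * (W * (2 ^ k * Real.exp (-E))) = W * 2 ^ k * (y * Real.exp (-E)) := by ring
          _ ≤ K₂ * l * 2 ^ k * (F / e) := by
            have := hWlarge hFy
            gcongr
          _ = K₂ * 2 ^ k / e * (F * l) := by ring
          _ ≤ _ := by
            have : 0 < K₂ * 2 ^ k := by positivity
            gcongr
            linarith
      · have h1 : Real.exp (-E) ≤ 1 := Real.exp_le_one_iff.2 (by linarith)
        calc y * (W * (2 ^ k * Real.exp (-E))) ≤ y * (W * (2 ^ k * 1)) := by gcongr
          _ = y * W * 2 ^ k := by ring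
          _ ≤ K₂ * F * l * 2 ^ k := by
            have := hWsmall hFy.le
            gcongr
          _ = K₂ * 2 ^ k * (F * l) := by ring
          _ ≤ _ := by
            have : 0 < K₂ * 2 ^ k / e := by positivity
            gcongr
            linarith
    have : 0 ≤ (4 * L + M * K₂ * 2 ^ k) * (F * l) := by positivity
    linarith

theorem integral_le_of_lintegral_ofReal_le {α : Type*} [MeasurableSpace α] {μ : Measure α}
    {g : α → ℝ} {b : ℝ} (hb : 0 ≤ b) (h : ∫⁻ a, ENNReal.ofReal (g a) ∂μ ≤ ENNReal.ofReal b) :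
    ∫ a, g a ∂μ ≤ b := by
  by_cases hg : Integrable g μ
  · rw [integral_eq_lintegral_pos_part_sub_lintegral_neg_part hg]
    have h1 := ENNReal.toReal_mono ENNReal.ofReal_ne_top h
    rw [ENNReal.toReal_ofReal hb] at h1
    exact (sub_le_self _ ENNReal.toReal_nonneg).trans h1
  · rwa [integral_undef hg]

noncomputable section

/-- `E[ln(f(X)/f_{R_k(X)}(X))] ≤ C n^{-s/(s+d)} ln(n+1)`, the
expectation taken over both `X ~ f` and the i.i.d. sample `X₁, …, Xₙ ~ f`. -/
theorem knn_log_ratio_reverse_upper_bound (d k : ℕ) (hd : 1 ≤ d) (hk : 1 ≤ k)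
    (s L : ℝ) (hs : 0 < s) (hs2 : s ≤ 2) (hL : 0 < L) :
    ∃ C : ℝ, 0 < C ∧ ∀ n : ℕ, k ≤ n → ∀ f : Euc d → ℝ, HolderDensity d s L f →
      (∫ ω : Euc d × (Fin n → Euc d),
          Real.log (f ω.1 / ballAvg d f (RkOfPoint d n k ω.1 ω.2) ω.1)
          ∂ (densityMeasure d f).prod (sampleMeasure d n f))
        ≤ C * (n : ℝ) ^ (-(s / (s + d))) * Real.log (n + 1) := by
  obtain ⟨c, M, hc, hc1, hM, hrad⟩ := exists_uniform_radius (d := d) hs hL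
  obtain ⟨C, hC, hopt⟩ := exists_truncation_radius k hd hs hL hc hc1 hM
  refine ⟨C, hC, fun n hkn f hf => ?_⟩
  have hbound : 0 ≤ C * (n : ℝ) ^ (-(s / (s + d))) * Real.log (n + 1) := by
    have : 0 ≤ Real.log ((n : ℝ) + 1) := Real.log_nonneg (by linarith [n.cast_nonneg (α := ℝ)])
    positivity
  set b := C * (n : ℝ) ^ (-(s / (s + d))) * Real.log (n + 1)
  have hprob := isProbabilityMeasure_densityMeasure hf.2.2.1 hf.2.2.2
  have : IsProbabilityMeasure (sampleMeasure d n f) := by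
    unfold sampleMeasure
    infer_instance
  refine integral_le_of_lintegral_ofReal_le hbound ((lintegral_prod_le _).trans ?_)
  refine (lintegral_withDensity_le_lintegral_mul _
    (hf.1.continuous hs).measurable.ennreal_ofReal _).trans ?_
  calc _ ≤ ∫⁻ _ in unitCube d, ENNReal.ofReal b := by
        refine setLIntegral_mono' (measurableSet_unitCube d) fun x hx => ?_
        rw [Pi.mul_apply]
        rcases (hf.2.2.1 x).eq_or_lt with h0 | h0
        · simp [← h0]
        · obtain ⟨hxM, hr, hhalf⟩ := hrad f hf x hx
          obtain ⟨u, hu, hur, hle⟩ := hopt n (hk.trans hkn) (f x) h0 hxM hr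
          grw [lintegral_log_div_ballAvg_le hd hk hkn hs hL hf hx h0 hu hur hr hhalf]
          rw [← ENNReal.ofReal_mul h0.le]
          exact ENNReal.ofReal_le_ofReal hle
    _ = ENNReal.ofReal b := by rw [setLIntegral_const, volume_unitCube, mul_one]

end
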